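/- arXiv:1510.01415 — 5 statements merged into one kernel-verified Lean document; each statement's English description precedes it below -/
import Mathlib

section
/- For every finite simple graph G and every probability distribution P on V(G), if H(G,P) = log₂ χ_f(G[{v ∈ V(G) : p_v > 0}]) (where G[·] denotes the induced subgraph on the support of P), then there exists a finite multiset S of independent sets of G such that (1) S is uniform over {v ∈ V(G) : p_v > 0}, and (2) every independent set I ∈ S is a maximum weighted independent set of G with respect to P. -/
open Finset

/-- `I` is an independent set of the graph `G`. -/
def IsIndepSet {V : Type*} (G : SimpleGraph V) (I : Finset V) : Prop :=
  ∀ u ∈ I, ∀ w ∈ I, ¬ G.Adj u w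

/-- The characteristic vector (in `ℝ^V`) of a finite set of vertices. -/
def charVec {V : Type*} [DecidableEq V] (I : Finset V) : V → ℝ :=
  fun v => if v ∈ I then 1 else 0

/-- The vertex packing polytope `VP(G)`: the convex hull of the characteristic
vectors of the independent sets of `G`. -/
def vertexPacking {V : Type*} [Fintype V] [DecidableEq V] (G : SimpleGraph V) : Set (V → ℝ) :=
  convexHull ℝ {x | ∃ I : Finset V, IsIndepSet G I ∧ x = charVec I}

/-- `P` is a probability distribution on the (finite) vertex set `V`. -/
def IsProbDist {V : Type*} [Fintype V] (P : V → ℝ) : Prop :=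
  (∀ v, 0 ≤ P v) ∧ ∑ v, P v = 1

/-- The entropy of the graph `G` with respect to `P`:
`H(G,P) = min_{a ∈ VP(G)} ∑_v p_v · log₂(1/a_v)`, where (by the convention
`0 · log₂(1/0) = 0`) coordinates with `p_v = 0` are irrelevant and the minimum
is never achieved with `a_v = 0` at a coordinate with `p_v > 0`; accordingly the
minimization is over points of `VP(G)` that are positive on the support of `P`. -/
noncomputable def graphEntropy {V : Type*} [Fintype V] [DecidableEq V]
    (G : SimpleGraph V) (P : V → ℝ) : ℝ :=
  sInf { x | ∃ a ∈ vertexPacking G, (∀ v, 0 < P v → 0 < a v) ∧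
      x = ∑ v, P v * Real.logb 2 (1 / a v) }

/-- The fractional chromatic number of `G`: the minimum of `∑_I w_I` over
nonnegative weight functions on the independent sets of `G` such that
`∑_{I ∋ v} w_I ≥ 1` for every vertex `v`. -/
noncomputable def fracChromatic {V : Type*} [Fintype V] [DecidableEq V]
    (G : SimpleGraph V) : ℝ :=
  sInf { x | ∃ w : Finset V → ℝ, (∀ I, 0 ≤ w I) ∧ (∀ I, w I ≠ 0 → IsIndepSet G I) ∧
      (∀ v : V, 1 ≤ ∑ I ∈ Finset.univ.filter (fun I : Finset V => v ∈ I), w I) ∧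
      x = ∑ I : Finset V, w I }

/-- The independence number `α(G)`. -/
noncomputable def indepNum {V : Type*} [Fintype V] (G : SimpleGraph V) : ℕ :=
  sSup {n | ∃ I : Finset V, IsIndepSet G I ∧ I.card = n}

/-- `I` is a maximum weighted independent set of `G` with respect to `P`. -/
def IsMaxWeightIndep {V : Type*} [Fintype V] (G : SimpleGraph V) (P : V → ℝ)
    (I : Finset V) : Prop :=
  IsIndepSet G I ∧ ∀ J : Finset V, IsIndepSet G J → ∑ v ∈ J, P v ≤ ∑ v ∈ I, P v

/-- A multiset `S` of (independent) sets uniformly covers `W` if every vertex of `W`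
belongs to exactly the same (positive) number of members of `S`, counted with
multiplicity. -/
def UniformOver {V : Type*} [DecidableEq V] (S : Multiset (Finset V)) (W : Set V) : Prop :=
  ∃ c : ℕ, 0 < c ∧ ∀ v ∈ W, (S.filter (fun I => v ∈ I)).card = c

/-- `G` is symmetric with respect to graph entropy: the uniform distribution
maximizes `H(G, ·)`. -/
def EntropySymmetric {V : Type*} [Fintype V] [DecidableEq V] (G : SimpleGraph V) : Prop :=
  ∀ P : V → ℝ, IsProbDist P →
    graphEntropy G P ≤ graphEntropy G (fun _ => (1 : ℝ) / Fintype.card V)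

lemma le_one_of_mem_vertexPacking {V : Type*} [Fintype V] [DecidableEq V] {G : SimpleGraph V}
    {a : V → ℝ} (ha : a ∈ vertexPacking G) (v : V) : a v ≤ 1 := by
  have hconv : Convex ℝ {x : V → ℝ | x v ≤ 1} :=
    convex_halfSpace_le (LinearMap.proj (R := ℝ) (φ := fun _ : V => ℝ) v).isLinear 1
  refine convexHull_min ?_ hconv ha
  rintro x ⟨I, -, rfl⟩
  simp only [charVec, Set.mem_ofPred_eq]
  split_ifs <;> norm_num

lemma graphEntropy_le {V : Type*} [Fintype V] [DecidableEq V] {G : SimpleGraph V} {P : V → ℝ}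
    (hP : IsProbDist P) {b : V → ℝ} (hb : b ∈ vertexPacking G) (hpos : ∀ v, 0 < P v → 0 < b v) :
    graphEntropy G P ≤ ∑ v, P v * Real.logb 2 (1 / b v) := by
  refine csInf_le ⟨0, ?_⟩ ⟨b, hb, hpos, rfl⟩
  rintro x ⟨a, ha, hapos, rfl⟩
  refine sum_nonneg fun v _ => ?_
  rcases (hP.1 v).eq_or_lt with h0 | h0
  · simp [← h0]
  · refine mul_nonneg h0.le (Real.logb_nonneg one_lt_two ?_)
    rw [le_div_iff₀ (hapos v h0), one_mul]
    exact le_one_of_mem_vertexPacking ha v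

lemma sum_mul_log_nonpos {V : Type*} [Fintype V] [DecidableEq V] {G : SimpleGraph V} {P : V → ℝ}
    (hP : IsProbDist P) {c : ℝ} (hc : 0 < c) (h : graphEntropy G P = Real.logb 2 c)
    {b : V → ℝ} (hb : b ∈ vertexPacking G) (hpos : ∀ v, 0 < P v → 0 < b v) :
    ∑ v, P v * Real.log (c * b v) ≤ 0 := by
  have key := graphEntropy_le hP hb hpos
  have h1 : ∑ v, P v * Real.log (c * b v) = Real.log c + ∑ v, P v * Real.log (b v) := by
    have : Real.log c = ∑ v, P v * Real.log c := by rw [← sum_mul, hP.2, one_mul]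
    rw [this, ← sum_add_distrib]
    refine sum_congr rfl fun v _ => ?_
    rcases (hP.1 v).eq_or_lt with h0 | h0
    · simp [← h0]
    · rw [Real.log_mul hc.ne' (hpos v h0).ne', mul_add]
  have h2 : ∑ v, P v * Real.logb 2 (1 / b v) = -(∑ v, P v * Real.log (b v)) / Real.log 2 := by
    rw [← sum_neg_distrib, sum_div]
    refine sum_congr rfl fun v _ => ?_
    rw [Real.logb, one_div, Real.log_inv]
    ring
  rw [h, h2, Real.logb, div_le_div_iff_of_pos_right (Real.log_pos one_lt_two)] at key
  linarith

/-- First-order optimality: if the constant vector `1 / c` on the support of `P` is realised in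
`VP(G)` and is optimal for `H(G,P)`, then no independent set has weight above `1 / c`. -/
lemma mul_weight_le_one {V : Type*} [Fintype V] [DecidableEq V] {G : SimpleGraph V} {P : V → ℝ}
    (hP : IsProbDist P) {c : ℝ} (hc : 1 ≤ c) (h : graphEntropy G P = Real.logb 2 c)
    {a : V → ℝ} (ha : a ∈ vertexPacking G) (hac : ∀ v, 0 < P v → c * a v = 1)
    {J : Finset V} (hJ : IsIndepSet G J) : c * ∑ v ∈ J, P v ≤ 1 := by
  have hc0 : 0 < c := by linarith
  have key : ∀ t : ℝ, 0 < t → t < 1 → c * ∑ v ∈ J, P v ≤ 1 + t * (c - 1) := by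
    intro t ht ht1
    set b : V → ℝ := (1 - t) • a + t • charVec J with hbdef
    have hb : b ∈ vertexPacking G :=
      convex_convexHull ℝ _ ha (subset_convexHull ℝ _ ⟨J, hJ, rfl⟩) (by linarith) ht.le (by ring)
    have hcb : ∀ v, 0 < P v → c * b v = 1 - t + t * c * charVec J v := by
      intro v hv
      simp only [hbdef, Pi.add_apply, Pi.smul_apply, smul_eq_mul]
      linear_combination (1 - t) * hac v hv
    have hchar : ∀ v, 0 ≤ charVec J v := fun v => by
      simp only [charVec]; split_ifs <;> norm_num
    have hcbpos : ∀ v, 0 < P v → 0 < c * b v := by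
      intro v hv
      rw [hcb v hv]
      have := mul_nonneg (mul_nonneg ht.le hc0.le) (hchar v)
      linarith
    have hs := sum_mul_log_nonpos hP hc0 h hb
      fun v hv => pos_of_mul_pos_right (hcbpos v hv) hc0.le
    have h1t : 0 < 1 - t := by linarith
    have h2t : 0 < 1 - t + t * c := by nlinarith
    have hlow : ∑ v, P v * ((1 - (1 - t)⁻¹) +
        ((1 - t)⁻¹ - (1 - t + t * c)⁻¹) * charVec J v) ≤ ∑ v, P v * Real.log (c * b v) := by
      refine sum_le_sum fun v _ => ?_
      rcases (hP.1 v).eq_or_lt with h0 | h0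
      · simp [← h0]
      · refine mul_le_mul_of_nonneg_left ?_ h0.le
        refine le_trans (le_of_eq ?_) (Real.one_sub_inv_le_log_of_pos (hcbpos v h0))
        rw [hcb v h0]
        simp only [charVec]
        split_ifs <;> simp
    have hsum : ∑ v, P v * ((1 - (1 - t)⁻¹) +
        ((1 - t)⁻¹ - (1 - t + t * c)⁻¹) * charVec J v) =
        (1 - (1 - t)⁻¹) + ((1 - t)⁻¹ - (1 - t + t * c)⁻¹) * ∑ v ∈ J, P v := by
      have hp : ∑ v ∈ J, P v = ∑ v, P v * charVec J v := by simp [charVec]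
      simp only [mul_add, sum_add_distrib, ← sum_mul, hP.2, one_mul, mul_left_comm (P _),
        ← mul_sum, ← hp]
    rw [hsum] at hlow
    set p := ∑ v ∈ J, P v
    have hfin : (1 - (1 - t)⁻¹) + ((1 - t)⁻¹ - (1 - t + t * c)⁻¹) * p =
        t * (c * p - (1 + t * (c - 1))) * ((1 - t)⁻¹ * (1 - t + t * c)⁻¹) := by
      field_simp
      ring
    rw [hfin] at hlow
    by_contra! hcon
    have : 0 < t * (c * p - (1 + t * (c - 1))) * ((1 - t)⁻¹ * (1 - t + t * c)⁻¹) :=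
      mul_pos (mul_pos ht (by linarith)) (mul_pos (inv_pos.2 h1t) (inv_pos.2 h2t))
    linarith
  by_contra! hcon
  set d := c * ∑ v ∈ J, P v - 1 with hd
  have hd0 : 0 < d := by linarith
  have ht : 0 < d / (d + c) := by positivity
  have := key (d / (d + c)) ht ((div_lt_one (by positivity)).2 (by linarith))
  have hlt : d / (d + c) * (c - 1) < d := by
    rw [div_mul_eq_mul_div, div_lt_iff₀ (by positivity)]
    nlinarith
  linarith

/-- An optimal fractional colouring exists. -/
lemma exists_fracChromatic_eq {U : Type*} [Fintype U] [DecidableEq U] (H : SimpleGraph U) :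
    ∃ w : Finset U → ℝ, (∀ I, 0 ≤ w I) ∧ (∀ I, w I ≠ 0 → IsIndepSet H I) ∧
      (∀ u : U, 1 ≤ ∑ I ∈ Finset.univ.filter (fun I : Finset U => u ∈ I), w I) ∧
      fracChromatic H = ∑ I : Finset U, w I := by
  set F : Set (Finset U → ℝ) := {w | (∀ I, 0 ≤ w I) ∧ (∀ I, w I ≠ 0 → IsIndepSet H I) ∧
      (∀ u : U, 1 ≤ ∑ I ∈ Finset.univ.filter (fun I : Finset U => u ∈ I), w I)} with hF
  have hFclosed : IsClosed F := by
    have h1 : IsClosed {w : Finset U → ℝ | ∀ I, 0 ≤ w I} := by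
      simp only [Set.ofPred_forall]
      exact isClosed_iInter fun I => isClosed_le continuous_const (continuous_apply I)
    have h2 : IsClosed {w : Finset U → ℝ | ∀ I, w I ≠ 0 → IsIndepSet H I} := by
      have : {w : Finset U → ℝ | ∀ I, w I ≠ 0 → IsIndepSet H I} =
          {w : Finset U → ℝ | ∀ I, ¬ IsIndepSet H I → w I = 0} := by
        ext w
        exact forall_congr' fun I => not_imp_comm
      rw [this]
      simp only [Set.ofPred_forall]
      exact isClosed_iInter fun I => isClosed_iInter fun _ =>
        isClosed_eq (continuous_apply I) continuous_const
    have h3 : IsClosed {w : Finset U → ℝ | ∀ u : U,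
        1 ≤ ∑ I ∈ Finset.univ.filter (fun I : Finset U => u ∈ I), w I} := by
      simp only [Set.ofPred_forall]
      exact isClosed_iInter fun u => isClosed_le continuous_const (by fun_prop)
    exact h1.inter (h2.inter h3)
  have hcont : Continuous fun w : Finset U → ℝ => ∑ I, w I := by fun_prop
  obtain ⟨w₀, hw₀⟩ : F.Nonempty := by
    refine ⟨fun I => if I.card = 1 then 1 else 0, fun I => by positivity, fun I hI => ?_,
      fun u => ?_⟩
    · have hI1 : I.card = 1 := by by_contra hne; simp [hne] at hI
      obtain ⟨x, rfl⟩ := card_eq_one.1 hI1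
      intro u hu v hv
      rw [mem_singleton.1 hu, mem_singleton.1 hv]
      exact H.loopless.irrefl x
    · refine le_trans (by simp) (single_le_sum (s := Finset.univ.filter
        (fun I : Finset U => u ∈ I)) (f := fun I : Finset U => if I.card = 1 then (1 : ℝ) else 0)
        (fun I _ => by positivity) (a := {u}) (by simp))
  set K : Set (Finset U → ℝ) := F ∩ {w | ∑ I, w I ≤ ∑ I, w₀ I}
  have hK : IsCompact K := by
    refine (isCompact_Icc (a := (0 : Finset U → ℝ)) (b := fun _ => ∑ I, w₀ I)).of_isClosed_subset
      (hFclosed.inter (isClosed_le hcont continuous_const)) ?_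
    rintro w ⟨hw, hle⟩
    exact ⟨hw.1, fun I => (single_le_sum (fun J _ => hw.1 J) (mem_univ I)).trans hle⟩
  obtain ⟨w, hwK, hmin⟩ := hK.exists_isMinOn ⟨w₀, hw₀, le_refl (∑ I, w₀ I)⟩ hcont.continuousOn
  refine ⟨w, hwK.1.1, hwK.1.2.1, hwK.1.2.2, ?_⟩
  refine IsLeast.csInf_eq ⟨⟨w, hwK.1.1, hwK.1.2.1, hwK.1.2.2, rfl⟩, ?_⟩
  rintro x ⟨z, hz1, hz2, hz3, rfl⟩
  rcases le_total (∑ I, z I) (∑ I, w₀ I) with hle | hle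
  · exact hmin ⟨⟨hz1, hz2, hz3⟩, hle⟩
  · exact le_trans hwK.2 hle

/-- Dirichlet's simultaneous approximation theorem, in qualitative form. -/
lemma exists_nat_forall_abs_mul_sub_int_lt {ι : Type*} [Fintype ι] (w : ι → ℝ) {ε : ℝ}
    (hε : 0 < ε) : ∃ N : ℕ, 0 < N ∧ ∃ n : ι → ℤ, ∀ i, |N * w i - n i| < ε := by
  obtain ⟨x, -, φ, hφ, hlim⟩ := (isCompact_Icc (a := (0 : ι → ℝ)) (b := 1)).tendsto_subseq
    (x := fun k : ℕ => fun i => Int.fract (k * w i))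
    fun k => ⟨fun i => Int.fract_nonneg _, fun i => (Int.fract_lt_one _).le⟩
  obtain ⟨k, hk⟩ := Metric.cauchySeq_iff'.1 hlim.cauchySeq ε hε
  have hlt : φ k < φ (k + 1) := hφ k.lt_succ_self
  refine ⟨φ (k + 1) - φ k, by omega,
    fun i => ⌊(φ (k + 1) : ℝ) * w i⌋ - ⌊(φ k : ℝ) * w i⌋, fun i => ?_⟩
  have h1 := (dist_le_pi_dist _ _ i).trans_lt (hk (k + 1) k.le_succ)
  simp only [Function.comp_apply, Real.dist_eq, Int.fract] at h1
  refine lt_of_eq_of_lt (congrArg _ ?_) h1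
  push_cast [Nat.cast_sub hlt.le]
  ring

/-- A nonnegative real solution of a system of `0/1` equations with right-hand sides `1` can be
replaced by a natural number solution with constant positive right-hand sides, without enlarging
the support. -/
lemma exists_nat_weights {ι U : Type*} [Fintype ι] (A : U → Finset ι) (w : ι → ℝ)
    (hw : ∀ i, 0 ≤ w i) (hA : ∀ u, ∑ i ∈ A u, w i = 1) :
    ∃ N : ℕ, 0 < N ∧ ∃ n : ι → ℕ, (∀ i, n i ≠ 0 → w i ≠ 0) ∧ ∀ u, ∑ i ∈ A u, n i = N := by
  set ε : ℝ := 1 / (Fintype.card ι + 1) with hε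
  have hε0 : 0 < ε := by positivity
  have hε1 : ε ≤ 1 := by
    rw [hε, div_le_one (by positivity)]
    linarith [(Nat.cast_nonneg (Fintype.card ι) : (0 : ℝ) ≤ _)]
  obtain ⟨N, hN, n, hn⟩ := exists_nat_forall_abs_mul_sub_int_lt w hε0
  have hn0 : ∀ i, 0 ≤ n i := by
    intro i
    have h1 := (abs_lt.1 (hn i)).2
    have h2 : (0 : ℝ) ≤ N * w i := mul_nonneg (Nat.cast_nonneg _) (hw i)
    have h3 : (-1 : ℝ) < n i := by linarith
    have h4 : (-1 : ℤ) < n i := by exact_mod_cast h3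
    omega
  refine ⟨N, hN, fun i => (n i).toNat, fun i hi hwi => ?_, fun u => ?_⟩
  · have h1 := hn i
    rw [hwi, mul_zero, zero_sub, abs_neg] at h1
    have h2 : |n i| < 1 := by exact_mod_cast h1.trans_le hε1
    rw [Int.abs_lt_one_iff] at h2
    simp [h2] at hi
  · have h1 : |(N : ℝ) - ∑ i ∈ A u, (n i : ℝ)| < 1 := by
      have : (N : ℝ) - ∑ i ∈ A u, (n i : ℝ) = ∑ i ∈ A u, (N * w i - n i) := by
        rw [sum_sub_distrib, ← mul_sum, hA, mul_one]
      rw [this]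
      calc |∑ i ∈ A u, (N * w i - n i)| ≤ ∑ i ∈ A u, |N * w i - n i| := abs_sum_le_sum_abs _ _
        _ ≤ ∑ i ∈ A u, ε := sum_le_sum fun i _ => (hn i).le
        _ ≤ ∑ _i : ι, ε := sum_le_sum_of_subset_of_nonneg (subset_univ _) fun _ _ _ => hε0.le
        _ < 1 := by
          rw [sum_const, card_univ, nsmul_eq_mul, hε, mul_one_div, div_lt_one (by positivity)]
          linarith
    have h2 : |(N : ℤ) - ∑ i ∈ A u, n i| < 1 := by exact_mod_cast h1
    rw [Int.abs_lt_one_iff] at h2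
    have h3 : ((∑ i ∈ A u, (n i).toNat : ℕ) : ℤ) = N := by
      rw [Nat.cast_sum, sum_congr rfl fun i _ => Int.toNat_of_nonneg (hn0 i)]
      linarith
    exact_mod_cast h3

lemma exists_uniformOver_range {V U : Type*} [Fintype V] [DecidableEq V] [Fintype U]
    [DecidableEq U] (G : SimpleGraph V) (P : V → ℝ) (hP : IsProbDist P) (f : U ↪ V)
    (hf : ∀ v, 0 < P v ↔ v ∈ Set.range f)
    (h : graphEntropy G P = Real.logb 2 (fracChromatic (G.comap f))) :
    ∃ S : Multiset (Finset V),
      UniformOver S {v : V | 0 < P v} ∧ ∀ I ∈ S, IsMaxWeightIndep G P I := by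
  obtain ⟨w, hw0, hwI, hwc, hχ⟩ := exists_fracChromatic_eq (G.comap f)
  rw [hχ] at h
  set c := ∑ I, w I with hc
  have hPf : ∀ u, 0 < P (f u) := fun u => (hf _).2 ⟨u, rfl⟩
  have hsum : ∀ g : V → ℝ, ∑ v, P v * g v = ∑ u, P (f u) * g (f u) := by
    intro g
    rw [← sum_map univ f (fun v => P v * g v)]
    refine (sum_subset (subset_univ _) fun v _ hv => ?_).symm
    have hv0 : ¬ 0 < P v := fun hpos => by
      obtain ⟨u, rfl⟩ := (hf v).1 hpos
      exact hv (by simp)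
    rw [le_antisymm (not_lt.1 hv0) (hP.1 v), zero_mul]
  have hPU : ∑ u, P (f u) = 1 := by
    have := hsum fun _ => 1
    simpa [hP.2] using this.symm
  obtain ⟨u₀⟩ : Nonempty U := by
    by_contra hne
    rw [not_nonempty_iff] at hne
    simp at hPU
  have hc1 : 1 ≤ c := (hwc u₀).trans
    (sum_le_sum_of_subset_of_nonneg (filter_subset _ _) fun I _ _ => hw0 I)
  have hc0 : 0 < c := by linarith
  have hindep : ∀ I, w I ≠ 0 → IsIndepSet G (I.map f) := by
    intro I hI x hx y hy
    obtain ⟨u, hu, rfl⟩ := mem_map.1 hx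
    obtain ⟨v, hv, rfl⟩ := mem_map.1 hy
    exact hwI I hI u hu v hv
  set a : V → ℝ := ∑ I ∈ univ.filter (fun I => w I ≠ 0), (w I / c) • charVec (I.map f) with ha_def
  have hwsum : ∑ I ∈ univ.filter (fun I => w I ≠ 0), w I = c := sum_filter_ne_zero univ
  have ha : a ∈ vertexPacking G := by
    refine (convex_convexHull ℝ _).sum_mem (fun I _ => div_nonneg (hw0 I) hc0.le) ?_ fun I hI =>
      subset_convexHull ℝ _ ⟨I.map f, hindep I (mem_filter.1 hI).2, rfl⟩
    rw [← sum_div, hwsum, div_self hc0.ne']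
  have hca : ∀ u, c * a (f u) = ∑ I ∈ univ.filter (fun I : Finset U => u ∈ I), w I := by
    intro u
    rw [ha_def, Finset.sum_apply, mul_sum, sum_filter, sum_filter]
    refine sum_congr rfl fun I _ => ?_
    by_cases hI : w I = 0
    · simp [hI]
    · by_cases hu : u ∈ I
      · simp [hI, hu, charVec]
        field_simp
      · simp [hI, hu, charVec]
  have hac : ∀ u, c * a (f u) = 1 := by
    have h1 : ∀ u, 1 ≤ c * a (f u) := fun u => by rw [hca]; exact hwc u
    have h2 : ∑ v, P v * Real.log (c * a v) ≤ 0 := by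
      refine sum_mul_log_nonpos hP hc0 h ha fun v hv => ?_
      obtain ⟨u, rfl⟩ := (hf v).1 hv
      exact pos_of_mul_pos_right (zero_lt_one.trans_le (h1 u)) hc0.le
    rw [hsum fun v => Real.log (c * a v)] at h2
    have h3 : ∀ u ∈ univ, 0 ≤ P (f u) * Real.log (c * a (f u)) :=
      fun u _ => mul_nonneg (hPf u).le (Real.log_nonneg (h1 u))
    have h4 := (sum_eq_zero_iff_of_nonneg h3).1 (le_antisymm h2 (sum_nonneg h3))
    intro u
    have h5 := (mul_eq_zero.1 (h4 u (mem_univ u))).resolve_left (hPf u).ne'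
    exact Real.eq_one_of_pos_of_log_eq_zero (zero_lt_one.trans_le (h1 u)) h5
  have hmax : ∀ J, IsIndepSet G J → c * ∑ v ∈ J, P v ≤ 1 := fun J hJ =>
    mul_weight_le_one hP hc1 h ha (fun v hv => by obtain ⟨u, rfl⟩ := (hf v).1 hv; exact hac u) hJ
  have htot : ∑ I, w I * ∑ v ∈ I.map f, P v = 1 := by
    have h1 : ∀ I : Finset U, w I * ∑ v ∈ I.map f, P v =
        ∑ u, P (f u) * if u ∈ I then w I else 0 := by
      intro I
      rw [sum_map, mul_sum]
      simp [mul_comm]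
    rw [sum_congr rfl fun I _ => h1 I, sum_comm, ← hPU]
    refine sum_congr rfl fun u _ => ?_
    rw [← mul_sum, ← sum_filter, ← hca, hac, mul_one]
  have hattain : ∀ I, w I ≠ 0 → c * ∑ v ∈ I.map f, P v = 1 := by
    have h1 : ∀ I ∈ univ, 0 ≤ w I * (1 - c * ∑ v ∈ I.map f, P v) := by
      intro I _
      by_cases hI : w I = 0
      · simp [hI]
      · exact mul_nonneg (hw0 I) (sub_nonneg.2 (hmax _ (hindep I hI)))
    have h2 : ∑ I, w I * (1 - c * ∑ v ∈ I.map f, P v) = 0 := by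
      have : ∑ I, w I * (1 - c * ∑ v ∈ I.map f, P v) =
          ∑ I, w I - c * ∑ I, w I * ∑ v ∈ I.map f, P v := by
        rw [mul_sum, ← sum_sub_distrib]
        exact sum_congr rfl fun I _ => by ring
      rw [this, htot, ← hc]
      ring
    intro I hI
    have := (mul_eq_zero.1 ((sum_eq_zero_iff_of_nonneg h1).1 h2 I (mem_univ I))).resolve_left hI
    linarith
  obtain ⟨N, hN, n, hnw, hnN⟩ := exists_nat_weights
    (fun u : U => univ.filter (fun I : Finset U => u ∈ I)) w hw0 fun u => by rw [← hca, hac]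
  refine ⟨∑ I, Multiset.replicate (n I) (I.map f), ⟨N, hN, fun v hv => ?_⟩, fun J hJ => ?_⟩
  · obtain ⟨u, rfl⟩ := (hf v).1 hv
    rw [← Multiset.countP_eq_card_filter, ← Multiset.coe_countPAddMonoidHom, map_sum, ← hnN u,
      sum_filter]
    refine sum_congr rfl fun I _ => ?_
    rw [Multiset.coe_countPAddMonoidHom, ← Multiset.coe_replicate, Multiset.coe_countP,
      List.countP_replicate]
    by_cases hu : u ∈ I <;> simp [hu]
  · obtain ⟨I, -, hI⟩ := Multiset.mem_sum.1 hJ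
    obtain ⟨hne, rfl⟩ := Multiset.mem_replicate.1 hI
    refine ⟨hindep I (hnw I hne), fun J' hJ' => ?_⟩
    exact le_of_mul_le_mul_left ((hmax J' hJ').trans (hattain I (hnw I hne)).ge) hc0

open Classical in
/-- If `H(G,P) = log₂ χ_f(G[support P])`, then there is a multiset of independent
sets that is uniform over the support of `P` and consists of maximum weighted
independent sets with respect to `P`. -/
theorem entropy_eq_logb_fracChromatic_support_imp_uniform_cover
    {V : Type*} [Fintype V] [DecidableEq V] (G : SimpleGraph V) (P : V → ℝ)
    (hP : IsProbDist P)
    (h : graphEntropy G P = Real.logb 2 (fracChromatic (G.induce {v : V | 0 < P v}))) :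
    ∃ S : Multiset (Finset V),
      UniformOver S {v : V | 0 < P v} ∧ ∀ I ∈ S, IsMaxWeightIndep G P I := by
  refine exists_uniformOver_range G P hP (Function.Embedding.subtype _) (fun v => ?_) h
  simp
end

section
/- Let G be a finite simple graph with probability distribution P on its vertex set. Suppose there exists a finite multiset S of independent sets of G such that (1) S is uniform over {v ∈ V(G) : p_v > 0}, and (2) every independent set I ∈ S is a maximum weighted independent set of G with respect to P. Then H(G,P) = log₂ χ_f(G[{v ∈ V(G) : p_v > 0}]), where G[·] denotes the induced subgraph on the support of P. -/
open Finset

section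

variable {V : Type*} [Fintype V] [DecidableEq V]

/-- Double counting: the total weight of a multiset of vertex sets. -/
theorem multiset_sum_weight_eq_sum_mul_card_filter (P : V → ℝ) (S : Multiset (Finset V)) :
    (S.map fun I => ∑ v ∈ I, P v).sum
      = ∑ v, P v * ((S.filter fun I => v ∈ I).card : ℝ) := by
  induction S using Multiset.induction_on with
  | empty => simp
  | cons I S ih =>
    have key : ∀ v, P v * (((I ::ₘ S).filter fun I => v ∈ I).card : ℝ)
        = (if v ∈ I then P v else 0) + P v * ((S.filter fun I => v ∈ I).card : ℝ) := by
      intro v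
      by_cases h : v ∈ I
      · simp [h]; ring
      · simp [h]
    simp only [key, Finset.sum_add_distrib, Multiset.map_cons, Multiset.sum_cons, ih]
    simp

theorem sum_count_filter_mem (S : Multiset (Finset V)) (v : V) :
    ∑ J ∈ Finset.univ.filter (fun J : Finset V => v ∈ J), S.count J
      = (S.filter fun I => v ∈ I).card := by
  rw [← Multiset.sum_count_eq_card (s := Finset.univ) (m := S.filter fun I => v ∈ I)
    (fun _ _ => Finset.mem_univ _), Finset.sum_filter]
  simp only [Multiset.count_filter]

/-- The common weight of the members of a uniform multiset of equal-weight sets. -/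
theorem card_mul_weight_eq_of_uniform {P : V → ℝ} (hP : IsProbDist P)
    {S : Multiset (Finset V)} {c : ℕ}
    (hc : ∀ v, 0 < P v → (S.filter fun I => v ∈ I).card = c)
    {M : ℝ} (hM : ∀ I ∈ S, ∑ v ∈ I, P v = M) : (S.card : ℝ) * M = c := by
  have h := multiset_sum_weight_eq_sum_mul_card_filter P S
  rw [Multiset.map_congr rfl hM, Multiset.map_const', Multiset.sum_replicate, nsmul_eq_mul] at h
  rw [h]
  calc ∑ v, P v * ((S.filter fun I => v ∈ I).card : ℝ) = ∑ v, P v * (c : ℝ) := by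
        refine Finset.sum_congr rfl fun v _ => ?_
        rcases (hP.1 v).eq_or_lt with h0 | h0
        · simp [← h0]
        · rw [hc v h0]
    _ = c := by rw [← Finset.sum_mul, hP.2, one_mul]

theorem card_pos_of_uniform {P : V → ℝ} (hP : IsProbDist P)
    {S : Multiset (Finset V)} {c : ℕ} (hc0 : 0 < c)
    (hc : ∀ v, 0 < P v → (S.filter fun I => v ∈ I).card = c) : 0 < S.card := by
  obtain ⟨v, -, hv⟩ : ∃ v ∈ Finset.univ, 0 < P v := by
    by_contra! h
    have := Finset.sum_nonpos h
    linarith [hP.2]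
  exact (hc v hv ▸ hc0).trans_le (Multiset.card_le_card (Multiset.filter_le _ _))

/-- Independent sets have weight at most the uniform covering density `c / |S|`. -/
theorem weight_le_of_uniform {G : SimpleGraph V} {P : V → ℝ} (hP : IsProbDist P)
    {S : Multiset (Finset V)} {c : ℕ} (hc0 : 0 < c)
    (hc : ∀ v, 0 < P v → (S.filter fun I => v ∈ I).card = c)
    (hMax : ∀ I ∈ S, IsMaxWeightIndep G P I) {J : Finset V} (hJ : IsIndepSet G J) :
    ∑ v ∈ J, P v ≤ c / S.card := by
  have hN := card_pos_of_uniform hP hc0 hc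
  obtain ⟨I₀, hI₀⟩ := Multiset.card_pos_iff_exists_mem.1 hN
  have h := card_mul_weight_eq_of_uniform hP hc (M := ∑ v ∈ I₀, P v) fun I hI =>
    le_antisymm ((hMax I₀ hI₀).2 I (hMax I hI).1) ((hMax I hI).2 I₀ (hMax I₀ hI₀).1)
  have hN' : (0 : ℝ) < S.card := by exact_mod_cast hN
  rw [le_div_iff₀ hN', ← h, mul_comm]
  exact mul_le_mul_of_nonneg_left ((hMax I₀ hI₀).2 J hJ) hN'.le

theorem fracChromatic_eq_card_div {G : SimpleGraph V} {P : V → ℝ} (hP : IsProbDist P)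
    {S : Multiset (Finset V)} {c : ℕ} (hc0 : 0 < c)
    (hc : ∀ v, (S.filter fun I => v ∈ I).card = c)
    (hMax : ∀ I ∈ S, IsMaxWeightIndep G P I) :
    fracChromatic G = S.card / c := by
  have hc' : (0 : ℝ) < c := by exact_mod_cast hc0
  have hN' : (0 : ℝ) < S.card := by
    exact_mod_cast card_pos_of_uniform hP hc0 fun v _ => hc v
  refine IsLeast.csInf_eq ⟨⟨fun I => S.count I / c, fun I => by positivity, fun I hI => ?_,
    fun v => ?_, ?_⟩, ?_⟩
  · refine (hMax I ?_).1
    by_contra h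
    simp [Multiset.count_eq_zero_of_notMem h] at hI
  · rw [← Finset.sum_div, ← Nat.cast_sum, sum_count_filter_mem, hc v, div_self hc'.ne']
  · rw [← Finset.sum_div, ← Nat.cast_sum,
      Multiset.sum_count_eq_card fun _ _ => Finset.mem_univ _]
  · rintro x ⟨w, hw0, hwI, hw1, rfl⟩
    have h1 : (1 : ℝ) ≤ ∑ I : Finset V, w I * (c / S.card) := by
      calc (1 : ℝ) = ∑ v, P v * 1 := by simp [hP.2]
        _ ≤ ∑ v, P v * ∑ I ∈ Finset.univ.filter (fun I : Finset V => v ∈ I), w I :=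
          Finset.sum_le_sum fun v _ => mul_le_mul_of_nonneg_left (hw1 v) (hP.1 v)
        _ = ∑ I : Finset V, w I * ∑ v ∈ I, P v := by
          simp only [Finset.sum_filter, Finset.mul_sum]
          rw [Finset.sum_comm]
          refine Finset.sum_congr rfl fun I _ => ?_
          rw [← Finset.sum_filter_add_sum_filter_not Finset.univ (fun v => v ∈ I)]
          rw [Finset.sum_eq_zero (s := Finset.univ.filter fun v => v ∉ I), add_zero]
          · simp only [Finset.filter_univ_mem]
            exact Finset.sum_congr rfl fun v hv => by simp [hv, mul_comm]
          · intro v hv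
            simp [(Finset.mem_filter.1 hv).2]
        _ ≤ _ := by
          refine Finset.sum_le_sum fun I _ => ?_
          by_cases h : w I = 0
          · simp [h]
          · exact mul_le_mul_of_nonneg_left
              (weight_le_of_uniform hP hc0 (fun v _ => hc v) hMax (hwI I h)) (hw0 I)
    rw [← Finset.sum_mul, ← mul_div_assoc, le_div_iff₀ hN', one_mul] at h1
    rwa [div_le_iff₀ hc']

/-- A linear bound on independent sets extends to the vertex packing polytope. -/
theorem sum_mul_le_of_mem_vertexPacking {G : SimpleGraph V} {P : V → ℝ} {M : ℝ}
    (hM : ∀ J, IsIndepSet G J → ∑ v ∈ J, P v ≤ M) {a : V → ℝ} (ha : a ∈ vertexPacking G) :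
    ∑ v, P v * a v ≤ M := by
  have hconv : Convex ℝ {a : V → ℝ | ∑ v, P v * a v ≤ M} := by
    refine convex_halfSpace_le ⟨fun x y => ?_, fun r x => ?_⟩ M
    · simp [mul_add, Finset.sum_add_distrib]
    · simp only [Pi.smul_apply, smul_eq_mul, Finset.mul_sum]
      exact Finset.sum_congr rfl fun v _ => by ring
  refine convexHull_min ?_ hconv ha
  rintro x ⟨I, hI, rfl⟩
  simpa [charVec] using hM I hI

theorem average_mem_vertexPacking {G : SimpleGraph V} {S : Multiset (Finset V)}
    (hS : ∀ I ∈ S, IsIndepSet G I) (hN : 0 < S.card) :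
    (fun v => ((S.filter fun I => v ∈ I).card : ℝ) / S.card) ∈ vertexPacking G := by
  have hN' : (0 : ℝ) < S.card := by exact_mod_cast hN
  have h : ∑ J ∈ S.toFinset, ((S.count J : ℝ) / S.card) • charVec J ∈ vertexPacking G := by
    refine (convex_convexHull ℝ _).sum_mem (fun J _ => by positivity) ?_ fun J hJ =>
      subset_convexHull ℝ _ ⟨J, hS J (Multiset.mem_toFinset.1 hJ), rfl⟩
    rw [← Finset.sum_div, ← Nat.cast_sum, Multiset.toFinset_sum_count_eq, div_self hN'.ne']
  convert h using 1
  ext v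
  rw [← sum_count_filter_mem, Finset.sum_apply, Nat.cast_sum, Finset.sum_div, Finset.sum_filter]
  symm
  refine Finset.sum_subset_zero_on_sdiff (Finset.subset_univ _) (fun J hJ => ?_) fun J _ => ?_
  · have : J ∉ S := by simpa using hJ
    simp [Multiset.count_eq_zero_of_notMem this]
  · simp [charVec]

theorem graphEntropy_eq_logb_card_div {G : SimpleGraph V} {P : V → ℝ} (hP : IsProbDist P)
    {S : Multiset (Finset V)} {c : ℕ} (hc0 : 0 < c)
    (hc : ∀ v, 0 < P v → (S.filter fun I => v ∈ I).card = c)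
    (hMax : ∀ I ∈ S, IsMaxWeightIndep G P I) :
    graphEntropy G P = Real.logb 2 (S.card / c) := by
  have hN := card_pos_of_uniform hP hc0 hc
  have hN' : (0 : ℝ) < S.card := by exact_mod_cast hN
  have hc' : (0 : ℝ) < c := by exact_mod_cast hc0
  refine IsLeast.csInf_eq ⟨⟨_, average_mem_vertexPacking (fun I hI => (hMax I hI).1) hN,
    fun v hv => ?_, ?_⟩, ?_⟩
  · simp only [hc v hv]
    positivity
  · calc Real.logb 2 (S.card / c) = ∑ v, P v * Real.logb 2 (S.card / c) := by
          rw [← Finset.sum_mul, hP.2, one_mul]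
      _ = _ := by
        refine Finset.sum_congr rfl fun v _ => ?_
        rcases (hP.1 v).eq_or_lt with h0 | h0
        · simp [← h0]
        · rw [hc v h0, one_div_div]
  · rintro x ⟨a, ha, hapos, rfl⟩
    have hM := sum_mul_le_of_mem_vertexPacking
      (fun J hJ => weight_le_of_uniform hP hc0 hc hMax hJ) ha
    set k : ℝ := S.card / c with hk
    have hk0 : 0 < k := by positivity
    have hM' : (∑ v, P v * a v) * k ≤ 1 := by
      rw [hk, ← mul_div_assoc, div_le_one hc']
      exact (le_div_iff₀ hN').1 hM
    have key : ∀ v, P v * (Real.log k + 1 - a v * k) ≤ P v * Real.log (1 / a v) := by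
      intro v
      rcases (hP.1 v).eq_or_lt with h0 | h0
      · simp [← h0]
      · have hav := hapos v h0
        refine mul_le_mul_of_nonneg_left ?_ h0.le
        have := Real.log_le_sub_one_of_pos (mul_pos hav hk0)
        rw [Real.log_mul hav.ne' hk0.ne'] at this
        rw [one_div, Real.log_inv]
        linarith
    have hsum : Real.log k ≤ ∑ v, P v * Real.log (1 / a v) := by
      refine le_trans ?_ (Finset.sum_le_sum fun v _ => key v)
      have : ∑ v, P v * (Real.log k + 1 - a v * k)
          = (∑ v, P v) * (Real.log k + 1) - (∑ v, P v * a v) * k := by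
        rw [Finset.sum_mul, Finset.sum_mul, ← Finset.sum_sub_distrib]
        exact Finset.sum_congr rfl fun v _ => by ring
      rw [this, hP.2]
      linarith
    simp only [Real.logb, ← mul_div_assoc, ← Finset.sum_div]
    exact div_le_div_of_nonneg_right hsum (Real.log_nonneg one_le_two)

end

theorem sum_subtype_support {V : Type*} {P : V → ℝ} (hP : ∀ v, 0 ≤ P v)
    [DecidablePred (· ∈ {v : V | 0 < P v})] (I : Finset V) :
    ∑ u ∈ I.subtype (· ∈ {v : V | 0 < P v}), P u = ∑ v ∈ I, P v := by
  rw [Finset.sum_subtype_eq_sum_filter]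
  refine Finset.sum_filter_of_ne fun v _ hv => lt_of_le_of_ne (hP v) hv.symm

theorem IsMaxWeightIndep.subtype_support {V : Type*} [Fintype V] {G : SimpleGraph V}
    {P : V → ℝ} (hP : ∀ v, 0 ≤ P v) [DecidablePred (· ∈ {v : V | 0 < P v})]
    [Fintype {v : V | 0 < P v}] {I : Finset V} (hI : IsMaxWeightIndep G P I) :
    IsMaxWeightIndep (G.induce {v : V | 0 < P v}) (fun u => P u)
      (I.subtype (· ∈ {v : V | 0 < P v})) := by
  refine ⟨fun u hu w hw h => hI.1 u (Finset.mem_subtype.1 hu) w (Finset.mem_subtype.1 hw) h,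
    fun J hJ => ?_⟩
  rw [sum_subtype_support hP]
  have := hI.2 (J.map (Function.Embedding.subtype _)) ?_
  · rw [Finset.sum_map] at this
    exact this
  · intro u hu w hw h
    obtain ⟨u', hu', rfl⟩ := Finset.mem_map.1 hu
    obtain ⟨w', hw', rfl⟩ := Finset.mem_map.1 hw
    exact hJ u' hu' w' hw' h

open Classical in
/-- If there is a multiset of independent sets that is uniform over the support of
`P` and consists of maximum weighted independent sets with respect to `P`, then
`H(G,P) = log₂ χ_f(G[support P])`. -/
theorem uniform_cover_imp_entropy_eq_logb_fracChromatic_support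
    {V : Type*} [Fintype V] [DecidableEq V] (G : SimpleGraph V) (P : V → ℝ)
    (hP : IsProbDist P) (S : Multiset (Finset V))
    (hUnif : UniformOver S {v : V | 0 < P v})
    (hMax : ∀ I ∈ S, IsMaxWeightIndep G P I) :
    graphEntropy G P = Real.logb 2 (fracChromatic (G.induce {v : V | 0 < P v})) := by
  obtain ⟨c, hc0, hc⟩ := hUnif
  rw [graphEntropy_eq_logb_card_div hP hc0 hc hMax]
  have hq : IsProbDist (fun u : {v : V | 0 < P v} => P u) := by
    refine ⟨fun u => hP.1 u, ?_⟩
    rw [← hP.2, ← sum_subtype_support hP.1]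
    exact Finset.sum_congr (by ext; simp) fun _ _ => rfl
  rw [fracChromatic_eq_card_div (S := S.map (Finset.subtype (· ∈ {v : V | 0 < P v}))) hq hc0,
    Multiset.card_map]
  · intro u
    rw [← hc u u.2, Multiset.filter_map, Multiset.card_map]
    congr 1
    exact Multiset.filter_congr fun I _ => by simp
  · intro J hJ
    obtain ⟨I, hI, rfl⟩ := Multiset.mem_map.1 hJ
    exact (hMax I hI).subtype_support hP.1
end

section
/- For a finite simple graph G on n vertices, the following are equivalent: (i) there exists a finite multiset S of independent sets of G such that every member of S is a maximum independent set of G (of size α(G)) and S is uniform over V(G) (i.e., S uniformly covers all vertices of G); (ii) χ_f(G) = n/α(G). -/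
open Finset

/-- Finitely many nonnegative reals are mapped to natural numbers, the positive ones to positive
ones, by an additive map. -/
theorem exists_addMonoidHom_eq_natCast {ι : Type*} [Fintype ι] (x : ι → ℝ) (hx : ∀ i, 0 ≤ x i) :
    ∃ (f : ℝ →+ ℚ) (k : ι → ℕ), (∀ i, f (x i) = k i) ∧ ∀ i, 0 < x i → 0 < k i := by
  classical
  let b := Module.Basis.ofVectorSpace ℚ ℝ
  let M : ι → ℝ := fun i => (b.repr (x i)).sum fun _ q => |(q : ℝ)|
  have hM : ∀ i, 0 ≤ M i := fun i => Finset.sum_nonneg fun _ _ => abs_nonneg _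
  obtain ⟨δ, hδ, hδx⟩ : ∃ δ : ℝ, 0 < δ ∧ ∀ i, 0 < x i → δ * M i < x i := by
    have h : ∀ᶠ δ : ℝ in nhdsWithin 0 (Set.Ioi 0), ∀ i, 0 < x i → δ * M i < x i := by
      refine Filter.eventually_all.2 fun i => ?_
      by_cases hi : 0 < x i
      · have ht : Filter.Tendsto (fun δ : ℝ => δ * M i) (nhdsWithin 0 (Set.Ioi 0)) (nhds 0) := by
          have : Continuous fun δ : ℝ => δ * M i := by fun_prop
          simpa using (this.tendsto 0).mono_left nhdsWithin_le_nhds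
        filter_upwards [ht.eventually_lt_const hi] with δ h _ using h
      · exact Filter.Eventually.of_forall fun δ h => absurd h hi
    obtain ⟨δ, h, hpos⟩ := (h.and self_mem_nhdsWithin).exists
    exact ⟨δ, hpos, h⟩
  have happrox : ∀ j, ∃ q : ℚ, |b j - q| < δ := fun j => exists_rat_near (b j) hδ
  choose q hq using happrox
  let g : ℝ →ₗ[ℚ] ℚ := b.constr ℚ q
  have hgx : ∀ i, |x i - g (x i)| ≤ δ * M i := by
    intro i
    have h1 : x i = (b.repr (x i)).sum fun j c => (c : ℝ) * b j := by
      conv_lhs => rw [← b.linearCombination_repr (x i), Finsupp.linearCombination_apply]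
      simp only [Rat.smul_def]
    have h2 : (g (x i) : ℝ) = (b.repr (x i)).sum fun j c => (c : ℝ) * q j := by
      simp only [g, Module.Basis.constr_apply, Finsupp.sum, smul_eq_mul]
      push_cast
      rfl
    have h3 : x i - g (x i) = (b.repr (x i)).sum fun j c => (c : ℝ) * (b j - q j) := by
      rw [h2]
      conv_lhs => enter [1]; rw [h1]
      simp only [Finsupp.sum, mul_sub, Finset.sum_sub_distrib]
    rw [h3]
    refine (Finset.abs_sum_le_sum_abs _ _).trans ?_
    rw [show δ * M i = ∑ j ∈ (b.repr (x i)).support, δ * |((b.repr (x i) j : ℚ) : ℝ)| from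
      Finset.mul_sum _ _ _]
    refine Finset.sum_le_sum fun j _ => ?_
    rw [abs_mul, mul_comm]
    exact mul_le_mul_of_nonneg_right (hq j).le (abs_nonneg _)
  have hgpos : ∀ i, 0 < x i → 0 < g (x i) := by
    intro i hi
    have h := (abs_le.1 (hgx i)).2
    have h' := hδx i hi
    exact_mod_cast (by linarith : (0 : ℝ) < g (x i))
  have hgnonneg : ∀ i, 0 ≤ g (x i) := by
    intro i
    rcases (hx i).eq_or_lt with h | h
    · simp [← h]
    · exact (hgpos i h).le
  let D : ℕ := ∏ i, (g (x i)).den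
  have hD : 0 < D := Finset.prod_pos fun i _ => (g (x i)).den_pos
  have hint : ∀ i, ∃ k : ℕ, (D : ℚ) * g (x i) = k := by
    intro i
    obtain ⟨e, he⟩ : (g (x i)).den ∣ D := Finset.dvd_prod_of_mem _ (Finset.mem_univ i)
    obtain ⟨m, hm⟩ := Int.eq_ofNat_of_zero_le (Rat.num_nonneg.2 (hgnonneg i))
    refine ⟨e * m, ?_⟩
    have h := Rat.den_mul_eq_num (g (x i))
    rw [hm] at h
    rw [he]
    push_cast at h ⊢
    rw [mul_right_comm, h, mul_comm]
  choose k hk using hint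
  refine ⟨(AddMonoidHom.mulLeft (D : ℚ)).comp g.toAddMonoidHom, k, hk, fun i hi => ?_⟩
  have h : (0 : ℚ) < D * g (x i) := mul_pos (by exact_mod_cast hD) (hgpos i hi)
  rw [hk i] at h
  exact_mod_cast h

/-- The number of members of a multiset with a given property is the sum of their multiplicities. -/
theorem card_filter_eq_sum_count {α : Type*} [Fintype α] [DecidableEq α] (S : Multiset α)
    (p : α → Prop) [DecidablePred p] :
    (S.filter p).card = ∑ a ∈ Finset.univ.filter p, S.count a := by
  rw [← Multiset.sum_count_eq_card (s := Finset.univ.filter p) (m := S.filter p) (by simp)]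
  refine Finset.sum_congr rfl fun a ha => ?_
  exact Multiset.count_filter_of_pos (Finset.mem_filter.1 ha).2

theorem isIndepSet_singleton {V : Type*} (G : SimpleGraph V) (v : V) :
    IsIndepSet G {v} := by
  intro u hu w hw
  rw [Finset.mem_singleton.1 hu, Finset.mem_singleton.1 hw]
  exact G.loopless.irrefl v

section FracColoring

variable {V : Type*} [Fintype V]

theorem bddAbove_card_isIndepSet (G : SimpleGraph V) :
    BddAbove {n | ∃ I : Finset V, IsIndepSet G I ∧ I.card = n} :=
  ⟨Fintype.card V, by rintro _ ⟨I, -, rfl⟩; exact I.card_le_univ⟩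

theorem IsIndepSet.card_le_indepNum {G : SimpleGraph V} {I : Finset V} (hI : IsIndepSet G I) :
    I.card ≤ indepNum G :=
  le_csSup (bddAbove_card_isIndepSet G) ⟨I, hI, rfl⟩

theorem indepNum_pos [Nonempty V] (G : SimpleGraph V) : 0 < indepNum G :=
  (isIndepSet_singleton G (Classical.arbitrary V)).card_le_indepNum

variable [DecidableEq V]

/-- `w` is a fractional coloring of `G`. -/
structure IsFracColoring (G : SimpleGraph V) (w : Finset V → ℝ) : Prop where
  nonneg : ∀ I, 0 ≤ w I
  isIndepSet : ∀ I, w I ≠ 0 → IsIndepSet G I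
  one_le : ∀ v : V, 1 ≤ ∑ I ∈ Finset.univ.filter (fun I : Finset V => v ∈ I), w I

theorem fracChromatic_eq_sInf_image (G : SimpleGraph V) :
    fracChromatic G = sInf ((fun w => ∑ I, w I) '' {w | IsFracColoring G w}) := by
  unfold fracChromatic
  congr 1
  ext x
  constructor
  · rintro ⟨w, h1, h2, h3, rfl⟩
    exact ⟨w, ⟨h1, h2, h3⟩, rfl⟩
  · rintro ⟨w, ⟨h1, h2, h3⟩, rfl⟩
    exact ⟨w, h1, h2, h3, rfl⟩

theorem sum_sum_mem_eq_sum_mul_card (w : Finset V → ℝ) :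
    ∑ v, ∑ I ∈ Finset.univ.filter (fun I : Finset V => v ∈ I), w I = ∑ I, w I * I.card := by
  simp_rw [Finset.sum_filter]
  rw [Finset.sum_comm]
  refine Finset.sum_congr rfl fun I _ => ?_
  rw [← Finset.sum_filter, Finset.sum_const, nsmul_eq_mul, mul_comm]
  congr 3
  ext v
  simp

namespace IsFracColoring

variable {G : SimpleGraph V} {w : Finset V → ℝ}

theorem mul_card_le (hw : IsFracColoring G w) (I : Finset V) :
    w I * I.card ≤ w I * indepNum G := by
  by_cases h : w I = 0
  · simp [h]
  · exact mul_le_mul_of_nonneg_left (by exact_mod_cast (hw.isIndepSet I h).card_le_indepNum)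
      (hw.nonneg I)

theorem card_le_sum_mul_card (hw : IsFracColoring G w) :
    (Fintype.card V : ℝ) ≤ ∑ I, w I * I.card := by
  rw [← sum_sum_mem_eq_sum_mul_card]
  calc (Fintype.card V : ℝ) = ∑ _v : V, (1 : ℝ) := by simp
    _ ≤ _ := Finset.sum_le_sum fun v _ => hw.one_le v

theorem card_le_sum_mul_indepNum (hw : IsFracColoring G w) :
    (Fintype.card V : ℝ) ≤ (∑ I, w I) * indepNum G := by
  rw [Finset.sum_mul]
  exact hw.card_le_sum_mul_card.trans (Finset.sum_le_sum fun I _ => hw.mul_card_le I)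

/-- A fractional coloring of total weight `n / α(G)` is supported on maximum independent sets. -/
theorem card_eq_indepNum (hw : IsFracColoring G w)
    (h : (∑ I, w I) * indepNum G = Fintype.card V) {I : Finset V} (hI : w I ≠ 0) :
    I.card = indepNum G := by
  have hsum : ∑ I, w I * I.card = ∑ I, w I * indepNum G :=
    le_antisymm (Finset.sum_le_sum fun I _ => hw.mul_card_le I) <| by
      rw [← Finset.sum_mul, h]
      exact hw.card_le_sum_mul_card
  have := (Finset.sum_eq_sum_iff_of_le fun I _ => hw.mul_card_le I).1 hsum I (Finset.mem_univ I)
  exact_mod_cast mul_left_cancel₀ hI this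

/-- A fractional coloring of total weight `n / α(G)` covers every vertex exactly once. -/
theorem sum_mem_eq_one (hw : IsFracColoring G w)
    (h : (∑ I, w I) * indepNum G = Fintype.card V) (v : V) :
    ∑ I ∈ Finset.univ.filter (fun I : Finset V => v ∈ I), w I = 1 := by
  have hsum : ∑ _v : V, (1 : ℝ)
      = ∑ v, ∑ I ∈ Finset.univ.filter (fun I : Finset V => v ∈ I), w I := by
    refine le_antisymm (Finset.sum_le_sum fun v _ => hw.one_le v) ?_
    rw [sum_sum_mem_eq_sum_mul_card]
    refine (Finset.sum_le_sum fun I _ => hw.mul_card_le I).trans ?_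
    rw [← Finset.sum_mul, h]
    simp
  exact ((Finset.sum_eq_sum_iff_of_le fun v _ => hw.one_le v).1 hsum v (Finset.mem_univ v)).symm

end IsFracColoring

theorem isFracColoring_singletons (G : SimpleGraph V) :
    IsFracColoring G fun I => if I.card = 1 then 1 else 0 where
  nonneg I := by positivity
  isIndepSet I h := by
    obtain ⟨v, rfl⟩ := Finset.card_eq_one.1 (by simpa using h)
    exact isIndepSet_singleton G v
  one_le v := by
    refine le_of_eq_of_le ?_ (Finset.single_le_sum (fun I _ => ?_)
      (Finset.mem_filter.2 ⟨Finset.mem_univ {v}, Finset.mem_singleton_self v⟩))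
    · simp
    · positivity

theorem isClosed_isFracColoring (G : SimpleGraph V) : IsClosed {w | IsFracColoring G w} := by
  have h : {w | IsFracColoring G w} =
      (⋂ I, {w | 0 ≤ w I}) ∩ ((⋂ I, ⋂ (_ : ¬ IsIndepSet G I), {w | w I = 0}) ∩
        ⋂ v : V, {w | 1 ≤ ∑ I ∈ Finset.univ.filter (fun I : Finset V => v ∈ I), w I}) := by
    ext w
    simp only [Set.mem_inter_iff, Set.mem_iInter, Set.mem_ofPred_eq]
    exact ⟨fun hw => ⟨hw.1, fun I => not_imp_comm.1 (hw.2 I), hw.3⟩,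
      fun hw => ⟨hw.1, fun I => not_imp_comm.1 (hw.2.1 I), hw.2.2⟩⟩
  rw [h]
  refine (isClosed_iInter fun I => isClosed_le (by fun_prop) (by fun_prop)).inter
    ((isClosed_iInter fun I => isClosed_iInter fun _ => isClosed_eq (by fun_prop)
      (by fun_prop)).inter (isClosed_iInter fun v => isClosed_le (by fun_prop) (by fun_prop)))

/-- The infimum defining the fractional chromatic number is attained. -/
theorem exists_isFracColoring_sum_eq_fracChromatic (G : SimpleGraph V) :
    ∃ w, IsFracColoring G w ∧ ∑ I, w I = fracChromatic G := by
  let w₀ : Finset V → ℝ := fun I => if I.card = 1 then 1 else 0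
  have hw₀ : IsFracColoring G w₀ := isFracColoring_singletons G
  let K : Set (Finset V → ℝ) := {w | IsFracColoring G w} ∩ {w | ∑ I, w I ≤ ∑ I, w₀ I}
  have hK : IsCompact K := by
    refine (isCompact_Icc (a := (0 : Finset V → ℝ)) (b := fun _ => ∑ I, w₀ I)).of_isClosed_subset
      ((isClosed_isFracColoring G).inter (isClosed_le (by fun_prop) (by fun_prop))) ?_
    rintro w ⟨hw, hle⟩
    exact ⟨hw.nonneg, fun I =>
      (Finset.single_le_sum (fun J _ => hw.nonneg J) (Finset.mem_univ I)).trans hle⟩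
  have hcont : ContinuousOn (fun w : Finset V → ℝ => ∑ I, w I) K := by fun_prop
  have hne : K.Nonempty := ⟨w₀, hw₀, le_refl (∑ I, w₀ I)⟩
  obtain ⟨w, hw, hmin⟩ := hK.exists_isMinOn hne hcont
  refine ⟨w, hw.1, ?_⟩
  rw [fracChromatic_eq_sInf_image]
  symm
  refine IsLeast.csInf_eq ⟨⟨w, hw.1, rfl⟩, ?_⟩
  rintro _ ⟨u, hu, rfl⟩
  by_cases h : ∑ I, u I ≤ ∑ I, w₀ I
  · exact hmin ⟨hu, h⟩
  · exact hw.2.trans (not_le.1 h).le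

theorem fracChromatic_eq_of_isFracColoring [Nonempty V] {G : SimpleGraph V} {w : Finset V → ℝ}
    (hw : IsFracColoring G w) (h : (∑ I, w I) * indepNum G = Fintype.card V) :
    fracChromatic G = (Fintype.card V : ℝ) / (indepNum G : ℝ) := by
  have hα : (0 : ℝ) < indepNum G := by exact_mod_cast indepNum_pos G
  rw [fracChromatic_eq_sInf_image]
  refine IsLeast.csInf_eq ⟨⟨w, hw, eq_div_of_mul_eq hα.ne' h⟩, ?_⟩
  rintro _ ⟨u, hu, rfl⟩
  exact (div_le_iff₀ hα).2 hu.card_le_sum_mul_indepNum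

end FracColoring

/-- `G` admits a multiset of maximum independent sets uniformly covering all of
`V(G)` iff `χ_f(G) = n / α(G)`. -/
theorem uniform_max_indep_cover_iff_fracChromatic_eq_card_div_indepNum
    {V : Type*} [Fintype V] [DecidableEq V] [Nonempty V] (G : SimpleGraph V) :
    (∃ S : Multiset (Finset V),
        (∀ I ∈ S, IsIndepSet G I ∧ I.card = indepNum G) ∧ UniformOver S Set.univ) ↔
      fracChromatic G = (Fintype.card V : ℝ) / (indepNum G : ℝ) := by
  constructor
  · rintro ⟨S, hS, c, hc, hcover⟩
    have hc' : (0 : ℝ) < c := by exact_mod_cast hc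
    let w : Finset V → ℝ := fun I => (S.count I : ℝ) / c
    have hmem : ∀ I, w I ≠ 0 → I ∈ S := by
      intro I hI
      by_contra h
      exact hI (by simp [w, Multiset.count_eq_zero_of_notMem h])
    have hone : ∀ v, ∑ I ∈ Finset.univ.filter (fun I : Finset V => v ∈ I), w I = 1 := by
      intro v
      have h := hcover v (Set.mem_univ v)
      rw [card_filter_eq_sum_count] at h
      rw [← Finset.sum_div, div_eq_one_iff_eq hc'.ne']
      exact_mod_cast h
    refine fracChromatic_eq_of_isFracColoring (w := w)
      ⟨fun I => by positivity, fun I hI => (hS I (hmem I hI)).1, fun v => (hone v).ge⟩ ?_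
    have h := sum_sum_mem_eq_sum_mul_card w
    simp only [hone, Finset.sum_const, Finset.card_univ, nsmul_eq_mul, mul_one] at h
    rw [h, Finset.sum_mul]
    refine Finset.sum_congr rfl fun I _ => ?_
    by_cases hI : w I = 0
    · simp [hI]
    · rw [(hS I (hmem I hI)).2]
  · intro hχ
    obtain ⟨w, hw, hsum⟩ := exists_isFracColoring_sum_eq_fracChromatic G
    have hα : (indepNum G : ℝ) ≠ 0 := by exact_mod_cast (indepNum_pos G).ne'
    have htotal : (∑ I, w I) * indepNum G = Fintype.card V := by
      rw [hsum, hχ, div_mul_cancel₀ _ hα]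
    obtain ⟨f, k, hfk, hk⟩ := exists_addMonoidHom_eq_natCast w hw.nonneg
    have hf : ∀ v, ((∑ I ∈ Finset.univ.filter (fun I : Finset V => v ∈ I), k I : ℕ) : ℚ) = f 1 := by
      intro v
      rw [← hw.sum_mem_eq_one htotal v, map_sum, Nat.cast_sum]
      exact Finset.sum_congr rfl fun I _ => (hfk I).symm
    let S : Multiset (Finset V) := Finsupp.toMultiset (Finsupp.equivFunOnFinite.symm k)
    have hcount : ∀ I, S.count I = k I := fun I => by simp [S, Finsupp.count_toMultiset]
    let v₀ : V := Classical.arbitrary V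
    refine ⟨S, fun I hI => ?_,
      ∑ I ∈ Finset.univ.filter (fun I : Finset V => v₀ ∈ I), k I, ?_, fun v _ => ?_⟩
    · have hI' : w I ≠ 0 := by
        intro h0
        have h := hfk I
        rw [h0, map_zero] at h
        have hkI : k I = 0 := by exact_mod_cast h.symm
        exact (Multiset.count_pos.2 hI).ne' ((hcount I).trans hkI)
      exact ⟨hw.isIndepSet I hI', hw.card_eq_indepNum htotal hI'⟩
    · obtain ⟨I, hI, hpos⟩ : ∃ I ∈ Finset.univ.filter (fun I : Finset V => v₀ ∈ I), 0 < w I :=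
        Finset.exists_lt_of_sum_lt (f := fun _ => (0 : ℝ)) <| by
          rw [hw.sum_mem_eq_one htotal v₀]
          simp
      exact Finset.sum_pos' (fun _ _ => Nat.zero_le _) ⟨I, hI, hk I hpos⟩
    · rw [card_filter_eq_sum_count]
      simp only [hcount]
      exact_mod_cast (hf v).trans (hf v₀).symm
end

section
/- For every finite simple graph G, the maximum of H(G,P) over all probability distributions P on V(G) equals log₂ χ_f(G). -/
open Finset

/-- Jensen's inequality for the logarithm: a bound on the mean bounds the mean logarithm. -/
lemma logb_le_sum_mul_logb_one_div {V : Type*} [Fintype V] {P b : V → ℝ}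
    (hP : IsProbDist P) (hb : ∀ v, 0 < P v → 0 < b v) {c : ℝ} (hc : 0 < c)
    (hle : ∑ v, P v * b v ≤ c⁻¹) :
    Real.logb 2 c ≤ ∑ v, P v * Real.logb 2 (1 / b v) := by
  have hlog : Real.log c ≤ ∑ v, P v * Real.log (1 / b v) := by
    have h (v : V) : P v * Real.log c + P v * (1 - c * b v) ≤ P v * Real.log (1 / b v) := by
      obtain h0 | h0 := (hP.1 v).eq_or_lt
      · simp [← h0]
      · have hbv := hb v h0
        have := Real.log_le_sub_one_of_pos (mul_pos hc hbv)
        rw [Real.log_mul hc.ne' hbv.ne'] at this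
        rw [← mul_add, one_div, Real.log_inv]
        exact mul_le_mul_of_nonneg_left (by linarith) h0.le
    have hsum := Finset.sum_le_sum fun v (_ : v ∈ Finset.univ) => h v
    have hexp : ∑ v, (P v * Real.log c + P v * (1 - c * b v)) =
        Real.log c + (1 - c * ∑ v, P v * b v) := by
      simp only [mul_sub, Finset.sum_add_distrib, Finset.sum_sub_distrib, ← Finset.sum_mul,
        Finset.mul_sum, hP.2, mul_one, one_mul, mul_left_comm c]
    have := mul_le_mul_of_nonneg_left hle hc.le
    rw [mul_inv_cancel₀ hc.ne'] at this
    linarith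
  simp only [Real.logb, ← mul_div_assoc]
  rw [← Finset.sum_div]
  exact div_le_div_of_nonneg_right hlog (Real.log_nonneg one_le_two)

section Entropy

variable {V : Type*} [Fintype V] [DecidableEq V]

/-- `w` is a nonnegative weight function supported on the independent sets of `G`. -/
def IsIndepWeight (G : SimpleGraph V) (w : Finset V → ℝ) : Prop :=
  (∀ I, 0 ≤ w I) ∧ ∀ I, w I ≠ 0 → IsIndepSet G I

/-- The total weight of the sets containing `v`. -/
def coverage (w : Finset V → ℝ) (v : V) : ℝ :=
  ∑ I ∈ Finset.univ.filter (fun I : Finset V => v ∈ I), w I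

/-- The possible total weights of fractional colorings of `G`. -/
def fracColoringValues (G : SimpleGraph V) : Set ℝ :=
  { x | ∃ w : Finset V → ℝ, (∀ I, 0 ≤ w I) ∧ (∀ I, w I ≠ 0 → IsIndepSet G I) ∧
      (∀ v : V, 1 ≤ ∑ I ∈ Finset.univ.filter (fun I : Finset V => v ∈ I), w I) ∧
      x = ∑ I : Finset V, w I }

lemma coverage_eq_sum_mul_charVec (w : Finset V → ℝ) (v : V) :
    coverage w v = ∑ I, w I * charVec I v := by
  simp [coverage, charVec, Finset.sum_filter]

lemma coverage_mem_vertexPacking {G : SimpleGraph V} {w : Finset V → ℝ}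
    (hw : IsIndepWeight G w) (hsum : ∑ I, w I = 1) : coverage w ∈ vertexPacking G := by
  have h : coverage w = ∑ I ∈ Finset.univ.filter (fun I => w I ≠ 0), w I • charVec I := by
    funext v
    rw [coverage_eq_sum_mul_charVec, Finset.sum_filter, Finset.sum_apply]
    refine Finset.sum_congr rfl fun I _ => ?_
    by_cases hI : w I = 0 <;> simp [hI]
  rw [h]
  refine (convex_convexHull ℝ _).sum_mem (fun I _ => hw.1 I) ?_ fun I hI => ?_
  · rwa [Finset.sum_filter_ne_zero]
  · exact subset_convexHull ℝ _ ⟨I, hw.2 I (Finset.mem_filter.1 hI).2, rfl⟩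

lemma exists_indepWeight_of_mem_vertexPacking {G : SimpleGraph V} {b : V → ℝ}
    (hb : b ∈ vertexPacking G) :
    ∃ w, IsIndepWeight G w ∧ ∑ I, w I = 1 ∧ b = coverage w := by
  refine convexHull_min (s := {x | ∃ I : Finset V, IsIndepSet G I ∧ x = charVec I})
    (t := {b | ∃ w, IsIndepWeight G w ∧ ∑ I, w I = 1 ∧ b = coverage w}) ?_ ?_ hb
  · rintro _ ⟨I, hI, rfl⟩
    refine ⟨Pi.single I 1, ⟨fun J => ?_, fun J hJ => ?_⟩, by simp, ?_⟩
    · by_cases h : J = I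
      · subst h; simp
      · simp [h]
    · by_cases h : J = I
      · rwa [h]
      · simp [h] at hJ
    · funext v
      simp [coverage_eq_sum_mul_charVec, Pi.single_apply]
  · rintro _ ⟨w, hw, hw1, rfl⟩ _ ⟨w', hw', hw1', rfl⟩ s t hs ht hst
    refine ⟨fun I => s * w I + t * w' I, ⟨fun I => ?_, fun I hI => ?_⟩, ?_, ?_⟩
    · have := hw.1 I
      have := hw'.1 I
      positivity
    · by_contra h
      have h1 : w I = 0 := by_contra fun h1 => h (hw.2 I h1)
      have h2 : w' I = 0 := by_contra fun h2 => h (hw'.2 I h2)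
      simp [h1, h2] at hI
    · rw [Finset.sum_add_distrib, ← Finset.mul_sum, ← Finset.mul_sum, hw1, hw1']
      simpa using hst
    · funext v
      simp [coverage, Finset.sum_add_distrib, Finset.mul_sum]

lemma coverage_le_sum {w : Finset V → ℝ} (hw : ∀ I, 0 ≤ w I) (v : V) :
    coverage w v ≤ ∑ I, w I :=
  Finset.sum_le_sum_of_subset_of_nonneg (Finset.filter_subset _ _) fun I _ _ => hw I

lemma mem_Icc_of_mem_vertexPacking {G : SimpleGraph V} {b : V → ℝ}
    (hb : b ∈ vertexPacking G) (v : V) : b v ∈ Set.Icc 0 1 := by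
  obtain ⟨w, hw, hw1, rfl⟩ := exists_indepWeight_of_mem_vertexPacking hb
  exact ⟨Finset.sum_nonneg fun I _ => hw.1 I, hw1 ▸ coverage_le_sum hw.1 v⟩

lemma zero_mem_vertexPacking (G : SimpleGraph V) : (0 : V → ℝ) ∈ vertexPacking G :=
  subset_convexHull ℝ _ ⟨∅, by simp [IsIndepSet], by funext v; simp [charVec]⟩

lemma fracColoringValues_nonempty (G : SimpleGraph V) : (fracColoringValues G).Nonempty := by
  refine ⟨_, fun I => if I.card = 1 then 1 else 0, fun I => ?_, fun I hI => ?_, fun v => ?_, rfl⟩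
  · dsimp only
    split_ifs <;> norm_num
  · have hI : I.card = 1 := by simpa using hI
    obtain ⟨a, rfl⟩ := Finset.card_eq_one.1 hI
    simp [IsIndepSet]
  · have h := Finset.single_le_sum (s := Finset.univ.filter (fun I : Finset V => v ∈ I))
      (f := fun I : Finset V => if I.card = 1 then (1 : ℝ) else 0)
      (fun I _ => by split_ifs <;> norm_num) (a := {v}) (by simp)
    simpa using h

lemma one_le_of_mem_fracColoringValues [Nonempty V] {G : SimpleGraph V} {x : ℝ}
    (hx : x ∈ fracColoringValues G) : 1 ≤ x := by
  obtain ⟨w, hw, -, hc, rfl⟩ := hx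
  obtain ⟨v⟩ := ‹Nonempty V›
  exact (hc v).trans (coverage_le_sum hw v)

lemma one_le_fracChromatic [Nonempty V] (G : SimpleGraph V) : 1 ≤ fracChromatic G :=
  le_csInf (fracColoringValues_nonempty G) fun _ => one_le_of_mem_fracColoringValues

lemma fracChromatic_le [Nonempty V] {G : SimpleGraph V} {x : ℝ}
    (hx : x ∈ fracColoringValues G) : fracChromatic G ≤ x :=
  csInf_le ⟨1, fun _ => one_le_of_mem_fracColoringValues⟩ hx

/-- A fractional coloring of total weight `x` yields a point of the vertex packing polytope
all of whose coordinates are at least `1 / x`. -/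
lemma exists_mem_vertexPacking_inv_le [Nonempty V] {G : SimpleGraph V} {x : ℝ}
    (hx : x ∈ fracColoringValues G) : ∃ a ∈ vertexPacking G, ∀ v, x⁻¹ ≤ a v := by
  have hx0 : 0 < x := one_pos.trans_le (one_le_of_mem_fracColoringValues hx)
  obtain ⟨w, hw, hi, hc, hsum⟩ := hx
  refine ⟨_, coverage_mem_vertexPacking (w := fun I => x⁻¹ * w I)
    ⟨fun I => mul_nonneg (by positivity) (hw I), fun I hI => hi I (right_ne_zero_of_mul hI)⟩ ?_,
    fun v => ?_⟩
  · rw [← Finset.mul_sum, ← hsum, inv_mul_cancel₀ hx0.ne']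
  · rw [coverage, ← Finset.mul_sum]
    exact le_mul_of_one_le_right (by positivity) (hc v)

lemma inv_mem_fracColoringValues {G : SimpleGraph V} {b : V → ℝ} {s : ℝ} (hs : 0 < s)
    (hb : b ∈ vertexPacking G) (hsb : ∀ v, s ≤ b v) : s⁻¹ ∈ fracColoringValues G := by
  obtain ⟨w, hw, hw1, rfl⟩ := exists_indepWeight_of_mem_vertexPacking hb
  refine ⟨fun I => s⁻¹ * w I, fun I => mul_nonneg (by positivity) (hw.1 I),
    fun I hI => hw.2 I (right_ne_zero_of_mul hI), fun v => ?_, ?_⟩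
  · rw [← Finset.mul_sum, inv_mul_eq_div, one_le_div hs]
    exact hsb v
  · rw [← Finset.mul_sum, hw1, mul_one]

lemma exists_le_inv_fracChromatic [Nonempty V] {G : SimpleGraph V} {b : V → ℝ}
    (hb : b ∈ vertexPacking G) : ∃ v, b v ≤ (fracChromatic G)⁻¹ := by
  by_contra! h
  obtain ⟨v, hv⟩ := Finite.exists_min b
  have hχ : 0 < fracChromatic G := one_pos.trans_le (one_le_fracChromatic G)
  have hpos : 0 < b v := (inv_pos.2 hχ).trans (h v)
  exact (fracChromatic_le (inv_mem_fracColoringValues hpos hb hv)).not_gt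
    (inv_lt_of_inv_lt₀ hχ (h v))

/-- The dual of the linear program for the fractional chromatic number. -/
lemma exists_probDist_sum_mul_le [Nonempty V] (G : SimpleGraph V) :
    ∃ P : V → ℝ, IsProbDist P ∧
      ∀ b ∈ vertexPacking G, ∑ v, P v * b v ≤ (fracChromatic G)⁻¹ := by
  set t := (fracChromatic G)⁻¹
  let U : Set (V → ℝ) := Set.univ.pi fun _ => Set.Ioi t
  have hdisj : Disjoint U (vertexPacking G) := Set.disjoint_left.2 fun b hbU hb => by
    obtain ⟨v, hv⟩ := exists_le_inv_fracChromatic hb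
    exact hv.not_gt (hbU v trivial)
  obtain ⟨f, u, hfU, hfV⟩ := geometric_hahn_banach_open
    (convex_pi fun _ _ => convex_Ioi t) (isOpen_set_pi Set.finite_univ fun _ _ => isOpen_Ioi)
    (convex_convexHull ℝ _) hdisj
  let q : V → ℝ := fun v => -f (Pi.single v 1)
  have hf (x : V → ℝ) : f x = -∑ v, q v * x v := by
    rw [← Finset.sum_neg_distrib, ← Finset.univ_sum_single x, map_sum]
    refine Finset.sum_congr rfl fun v _ => ?_
    have : (Pi.single v (x v) : V → ℝ) = x v • Pi.single v 1 := by
      rw [← Pi.single_smul]; simp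
    rw [Finset.univ_sum_single, this, map_smul]
    simp [q, mul_comm]
  have hu : u ≤ 0 := by simpa using hfV 0 (zero_mem_vertexPacking G)
  have hconst {ε : ℝ} (hε : 0 < ε) : -u < (∑ v, q v) * (t + ε) := by
    have := hfU (fun _ => t + ε) fun v _ => by simpa using hε
    rw [hf, ← Finset.sum_mul] at this
    linarith
  have hq (v : V) : 0 ≤ q v := by
    by_contra! hv
    obtain ⟨K, hK⟩ := exists_nat_gt (((∑ v, q v) * (t + 1) + u) / -q v)
    have := hfU (fun w => (t + 1) + K * Pi.single (M := fun _ => ℝ) v 1 w) fun w _ => by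
      have : (0 : ℝ) ≤ Pi.single (M := fun _ => ℝ) v 1 w := by
        rw [Pi.single_apply]; split_ifs <;> norm_num
      have : 0 ≤ K * Pi.single (M := fun _ => ℝ) v 1 w := by positivity
      simp only [Set.mem_Ioi]
      linarith
    rw [hf] at this
    simp only [mul_add (q _), Finset.sum_add_distrib, ← Finset.sum_mul] at this
    simp only [Pi.single_apply, mul_ite, mul_one, mul_zero, Finset.sum_ite_eq',
      Finset.mem_univ, if_true] at this
    rw [div_lt_iff₀ (by linarith)] at hK
    nlinarith
  have ht : 0 < t := inv_pos.2 (one_pos.trans_le (one_le_fracChromatic G))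
  have hS : 0 < ∑ v, q v := by
    have := hconst one_pos
    exact (mul_pos_iff_of_pos_right (by positivity)).1 ((neg_nonneg.2 hu).trans_lt this)
  have hle : -u ≤ (∑ v, q v) * t := by
    refine le_of_forall_pos_le_add fun ε hε => ?_
    have := hconst (div_pos hε hS)
    rw [mul_add, mul_div_cancel₀ _ hS.ne'] at this
    exact this.le
  refine ⟨fun v => q v / ∑ v, q v, ⟨fun v => div_nonneg (hq v) hS.le, ?_⟩, fun b hb => ?_⟩
  · rw [← Finset.sum_div, div_self hS.ne']
  · have := hfV b hb
    rw [hf] at this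
    simp only [div_mul_eq_mul_div]
    rw [← Finset.sum_div, div_le_iff₀ hS]
    linarith

lemma graphEntropy_le_logb [Nonempty V] {G : SimpleGraph V} {P : V → ℝ} (hP : IsProbDist P)
    {x : ℝ} (hx : x ∈ fracColoringValues G) : graphEntropy G P ≤ Real.logb 2 x := by
  have hx0 : 0 < x := one_pos.trans_le (one_le_of_mem_fracColoringValues hx)
  obtain ⟨a, ha, hxa⟩ := exists_mem_vertexPacking_inv_le hx
  have hpos (v : V) : 0 < a v := (inv_pos.2 hx0).trans_le (hxa v)
  have hbdd : BddBelow { x | ∃ a ∈ vertexPacking G, (∀ v, 0 < P v → 0 < a v) ∧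
      x = ∑ v, P v * Real.logb 2 (1 / a v) } := by
    refine ⟨0, ?_⟩
    rintro _ ⟨b, hb, -, rfl⟩
    refine Finset.sum_nonneg fun v _ => mul_nonneg (hP.1 v) ?_
    obtain ⟨h0, h1⟩ := mem_Icc_of_mem_vertexPacking hb v
    rw [one_div, Real.logb_inv]
    exact neg_nonneg.2 (Real.logb_nonpos one_lt_two h0 h1)
  calc graphEntropy G P ≤ ∑ v, P v * Real.logb 2 (1 / a v) :=
        csInf_le hbdd ⟨a, ha, fun v _ => hpos v, rfl⟩
    _ ≤ ∑ v, P v * Real.logb 2 x := by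
        refine Finset.sum_le_sum fun v _ => mul_le_mul_of_nonneg_left ?_ (hP.1 v)
        refine Real.logb_le_logb_of_le one_lt_two (one_div_pos.2 (hpos v)) ?_
        rw [one_div]
        exact inv_le_of_inv_le₀ hx0 (hxa v)
    _ = Real.logb 2 x := by rw [← Finset.sum_mul, hP.2, one_mul]

lemma graphEntropy_le_logb_fracChromatic [Nonempty V] (G : SimpleGraph V) {P : V → ℝ}
    (hP : IsProbDist P) : graphEntropy G P ≤ Real.logb 2 (fracChromatic G) := by
  rw [Real.le_logb_iff_rpow_le one_lt_two (one_pos.trans_le (one_le_fracChromatic G))]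
  refine le_csInf (fracColoringValues_nonempty G) fun x hx => ?_
  rw [← Real.le_logb_iff_rpow_le one_lt_two
    (one_pos.trans_le (one_le_of_mem_fracColoringValues hx))]
  exact graphEntropy_le_logb hP hx

end Entropy

/-- The maximum of `H(G,P)` over all probability distributions `P` on `V(G)`
equals `log₂ χ_f(G)`. -/
theorem isGreatest_graphEntropy_logb_fracChromatic
    {V : Type*} [Fintype V] [DecidableEq V] [Nonempty V] (G : SimpleGraph V) :
    IsGreatest {x : ℝ | ∃ P : V → ℝ, IsProbDist P ∧ x = graphEntropy G P}
      (Real.logb 2 (fracChromatic G)) := by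
  refine ⟨?_, ?_⟩
  · obtain ⟨P, hP, hle⟩ := exists_probDist_sum_mul_le G
    have hχ : 0 < fracChromatic G := one_pos.trans_le (one_le_fracChromatic G)
    refine ⟨P, hP, le_antisymm ?_ (graphEntropy_le_logb_fracChromatic G hP)⟩
    obtain ⟨x, hx⟩ := fracColoringValues_nonempty G
    have hx0 : 0 < x := one_pos.trans_le (one_le_of_mem_fracColoringValues hx)
    obtain ⟨a, ha, hxa⟩ := exists_mem_vertexPacking_inv_le hx
    refine le_csInf ⟨_, a, ha, fun v _ => (inv_pos.2 hx0).trans_le (hxa v), rfl⟩ ?_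
    rintro _ ⟨b, hb, hpos, rfl⟩
    exact logb_le_sum_mul_logb_one_div hP hpos hχ (hle b hb)
  · rintro _ ⟨P, hP, rfl⟩
    exact graphEntropy_le_logb_fracChromatic G hP
end

section
/- For every finite simple graph G, the map P ↦ H(G,P) is continuous at every strictly positive probability distribution P on V(G); explicitly, for every strictly positive distribution P and every ε > 0 there exists δ > 0 such that every probability distribution P′ on V(G) with ‖P′ − P‖_∞ < δ satisfies |H(G,P′) − H(G,P)| < ε. -/
open Finset

theorem vertexPacking_subset_Icc {V : Type*} [Fintype V] [DecidableEq V] (G : SimpleGraph V) :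
    vertexPacking G ⊆ Set.Icc 0 1 := by
  refine convexHull_min ?_ (convex_Icc 0 1)
  rintro _ ⟨I, -, rfl⟩
  constructor <;> intro v <;> by_cases hv : v ∈ I <;> simp [charVec, hv]

theorem IsProbDist.mem_vertexPacking {V : Type*} [Fintype V] [DecidableEq V] {P : V → ℝ}
    (hP : IsProbDist P) (G : SimpleGraph V) : P ∈ vertexPacking G := by
  have hsum : P = ∑ v, P v • charVec {v} := by
    ext w
    simp [charVec, Finset.sum_apply]
  rw [hsum]
  refine (convex_convexHull ℝ _).sum_mem (fun v _ => hP.1 v) hP.2 fun v _ =>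
    subset_convexHull ℝ _ ⟨{v}, ?_, rfl⟩
  intro u hu w hw
  rw [Finset.mem_singleton.1 hu, Finset.mem_singleton.1 hw]
  exact G.irrefl

theorem logb_one_div_nonneg_of_mem_vertexPacking {V : Type*} [Fintype V] [DecidableEq V]
    {G : SimpleGraph V} {a : V → ℝ} (ha : a ∈ vertexPacking G) (v : V) :
    0 ≤ Real.logb 2 (1 / a v) := by
  have h := vertexPacking_subset_Icc G ha
  rw [one_div, Real.logb_inv, neg_nonneg]
  exact Real.logb_nonpos one_lt_two (h.1 v) (h.2 v)

theorem graphEntropy_nonneg {V : Type*} [Fintype V] [DecidableEq V] (G : SimpleGraph V)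
    {P : V → ℝ} (hP : ∀ v, 0 ≤ P v) : 0 ≤ graphEntropy G P := by
  refine Real.sInf_nonneg ?_
  rintro _ ⟨a, ha, -, rfl⟩
  exact Finset.sum_nonneg fun v _ =>
    mul_nonneg (hP v) (logb_one_div_nonneg_of_mem_vertexPacking ha v)

theorem graphEntropy_le_mul {V : Type*} [Fintype V] [DecidableEq V] (G : SimpleGraph V)
    {P Q : V → ℝ} (hP : IsProbDist P) (hQ : ∀ v, 0 ≤ Q v) {c : ℝ} (hc : 0 < c)
    (h : ∀ v, Q v ≤ c * P v) : graphEntropy G Q ≤ c * graphEntropy G P := by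
  rw [← div_le_iff₀' hc]
  refine le_csInf ⟨_, P, hP.mem_vertexPacking G, fun v hv => hv, rfl⟩ ?_
  rintro _ ⟨a, ha, hpos, rfl⟩
  rw [div_le_iff₀' hc, Finset.mul_sum]
  have hmem : graphEntropy G Q ≤ ∑ v, Q v * Real.logb 2 (1 / a v) := by
    refine csInf_le ⟨0, ?_⟩ ⟨a, ha, fun v hv => hpos v ?_, rfl⟩
    · rintro _ ⟨b, hb, -, rfl⟩
      exact Finset.sum_nonneg fun v _ =>
        mul_nonneg (hQ v) (logb_one_div_nonneg_of_mem_vertexPacking hb v)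
    · exact pos_of_mul_pos_right (hv.trans_le (h v)) hc.le
  refine hmem.trans (Finset.sum_le_sum fun v _ => ?_)
  rw [← mul_assoc]
  exact mul_le_mul_of_nonneg_right (h v) (logb_one_div_nonneg_of_mem_vertexPacking ha v)

/-- `P ↦ H(G,P)` is continuous at every strictly positive probability
distribution `P` (with respect to the sup norm). -/
theorem graphEntropy_continuous_at_strictly_positive
    {V : Type*} [Fintype V] [DecidableEq V] (G : SimpleGraph V)
    (P : V → ℝ) (hP : IsProbDist P) (hpos : ∀ v, 0 < P v) :
    ∀ ε : ℝ, 0 < ε → ∃ δ : ℝ, 0 < δ ∧ ∀ P' : V → ℝ, IsProbDist P' →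
      (∀ v, |P' v - P v| < δ) →
      |graphEntropy G P' - graphEntropy G P| < ε := by
  intro ε hε
  have hne : Nonempty V := by
    by_contra hV
    rw [not_nonempty_iff] at hV
    simpa using hP.2
  obtain ⟨u, hu⟩ := Finite.exists_min P
  have hH := graphEntropy_nonneg G hP.1
  obtain ⟨η, hη, hη1, hηε⟩ : ∃ η : ℝ, 0 < η ∧ η < 1 ∧ η * graphEntropy G P < ε := by
    refine ⟨min (1 / 2) (ε / (graphEntropy G P + 1)), by positivity,
      (min_le_left _ _).trans_lt (by norm_num), ?_⟩
    calc min (1 / 2) (ε / (graphEntropy G P + 1)) * graphEntropy G P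
        ≤ ε / (graphEntropy G P + 1) * graphEntropy G P :=
          mul_le_mul_of_nonneg_right (min_le_right _ _) hH
      _ < ε := by
          rw [div_mul_eq_mul_div, div_lt_iff₀ (by positivity)]
          nlinarith
  refine ⟨η * P u, mul_pos hη (hpos u), fun P' hP' hδ => ?_⟩
  have hclose : ∀ v, |P' v - P v| ≤ η * P v := fun v =>
    (hδ v).le.trans (mul_le_mul_of_nonneg_left (hu v) hη.le)
  have hη' : 0 < 1 - η := sub_pos.2 hη1
  have hupper : graphEntropy G P' ≤ (1 + η) * graphEntropy G P :=
    graphEntropy_le_mul G hP hP'.1 (by positivity) fun v => by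
      linarith [(abs_le.1 (hclose v)).2]
  have hlower : graphEntropy G P ≤ (1 - η)⁻¹ * graphEntropy G P' :=
    graphEntropy_le_mul G hP' hP.1 (inv_pos.2 hη') fun v => by
      rw [le_inv_mul_iff₀ hη']
      linarith [(abs_le.1 (hclose v)).1]
  rw [le_inv_mul_iff₀ hη'] at hlower
  rw [abs_lt]
  constructor <;> linarith
end
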